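/- arXiv:2409.05355 — 2 statements merged into one kernel-verified Lean document; each statement's English description precedes it below -/
import Mathlib

section
/- Let T > 0, τ ∈ (0,1], let α̲ > 0, and let α : [0,T] → ℝ be integrable with α(r) ≥ α̲ for almost every r ∈ [0,T]. Set C_∞ = 1 + (1 − exp(−α̲ T))⁻¹ and C₁ = C_∞/α̲. Then for every p ∈ (1,∞) with conjugate exponent p* = p/(p−1) and every t ∈ [0,T], one has (∫₀ᵀ Ψ(s,t)^{p*} ds)^{1/p*} ≤ C_∞^{1/p} · (C₁ τ)^{1/p*}. -/
open MeasureTheory Set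

theorem mul_sub_le_intervalIntegral_of_ae_le {T a : ℝ} {f : ℝ → ℝ}
    (hint : IntegrableOn f (Icc 0 T) volume)
    (hge : ∀ᵐ r ∂(volume.restrict (Icc (0:ℝ) T)), a ≤ f r)
    {s t : ℝ} (hs : 0 ≤ s) (hst : s ≤ t) (ht : t ≤ T) :
    a * (t - s) ≤ ∫ r in s..t, f r := by
  have hsub : Icc s t ⊆ Icc 0 T := Icc_subset_Icc hs ht
  have hf : IntervalIntegrable f volume s t :=
    (intervalIntegrable_iff_integrableOn_Icc_of_le hst).2 (hint.mono_set hsub)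
  have h := intervalIntegral.integral_mono_ae_restrict hst
    (intervalIntegrable_const (c := a)) hf (ae_restrict_of_ae_restrict_of_subset hsub hge)
  rw [intervalIntegral.integral_const, smul_eq_mul] at h
  linarith

theorem intervalIntegral_exp_neg_mul_sub_le {c : ℝ} (hc : 0 < c) (t : ℝ) :
    ∫ s in (0:ℝ)..t, Real.exp (-(c * (t - s))) ≤ 1 / c := by
  have hderiv : ∀ s ∈ uIcc 0 t,
      HasDerivAt (fun s => Real.exp (-(c * (t - s))) / c) (Real.exp (-(c * (t - s)))) s := by
    intro s _
    have h := ((((hasDerivAt_id s).const_sub t).const_mul c).neg.exp).div_const c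
    refine h.congr_deriv ?_
    simp only [id, Pi.neg_apply]
    field_simp
  rw [intervalIntegral.integral_eq_sub_of_hasDerivAt hderiv
    (Continuous.intervalIntegrable (by fun_prop) _ _)]
  have h : 0 ≤ Real.exp (-(c * (t - 0))) / c := by positivity
  simp only [sub_self, mul_zero, neg_zero, Real.exp_zero]
  linarith

/-- Interpolation between an `L^∞` bound `M` and an integrable majorant of integral at most `B`. -/
theorem rpow_intervalIntegral_rpow_le {T M B p q : ℝ} (hpq : p.HolderConjugate q) (hT : 0 ≤ T)
    (hM : 0 < M) {f g : ℝ → ℝ} (hf0 : ∀ s ∈ Ioc 0 T, 0 ≤ f s) (hfM : ∀ s ∈ Ioc 0 T, f s ≤ M)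
    (hfg : ∀ s ∈ Ioc 0 T, f s ≤ g s) (hg : IntegrableOn g (Ioc 0 T) volume)
    (hB : ∫ s in Ioc 0 T, g s ≤ B) :
    (∫ s in (0:ℝ)..T, f s ^ q) ^ (1 / q) ≤ M ^ (1 / p) * B ^ (1 / q) := by
  have hq := hpq.symm.pos
  have hq1 : 0 < q - 1 := by linarith [hpq.symm.lt]
  have hB0 : 0 ≤ B := (setIntegral_nonneg measurableSet_Ioc
    fun s hs => (hf0 s hs).trans (hfg s hs)).trans hB
  have hle : ∫ s in (0:ℝ)..T, f s ^ q ≤ M ^ (q - 1) * B := by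
    rw [intervalIntegral.integral_of_le hT]
    calc ∫ s in Ioc 0 T, f s ^ q ≤ ∫ s in Ioc 0 T, M ^ (q - 1) * g s := by
          refine integral_mono_of_nonneg ?_ (hg.const_mul _) ?_
          · exact (ae_restrict_iff' measurableSet_Ioc).2
              (.of_forall fun s hs => Real.rpow_nonneg (hf0 s hs) _)
          · refine (ae_restrict_iff' measurableSet_Ioc).2 (.of_forall fun s hs => ?_)
            calc f s ^ q = f s ^ (q - 1) * f s := by
                  rw [← Real.rpow_add_one' (hf0 s hs) (by linarith), sub_add_cancel]
              _ ≤ M ^ (q - 1) * g s :=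
                  mul_le_mul (Real.rpow_le_rpow (hf0 s hs) (hfM s hs) hq1.le) (hfg s hs)
                    (hf0 s hs) (by positivity)
      _ = M ^ (q - 1) * ∫ s in Ioc 0 T, g s := integral_const_mul _ _
      _ ≤ M ^ (q - 1) * B := by gcongr
  have h0 : 0 ≤ ∫ s in (0:ℝ)..T, f s ^ q := by
    rw [intervalIntegral.integral_of_le hT]
    exact setIntegral_nonneg measurableSet_Ioc fun s hs => Real.rpow_nonneg (hf0 s hs) _
  have hexp : (q - 1) * (1 / q) = 1 / p := by
    have h := hpq.inv_add_inv_eq_one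
    field_simp at h ⊢
    linarith
  calc (∫ s in (0:ℝ)..T, f s ^ q) ^ (1 / q) ≤ (M ^ (q - 1) * B) ^ (1 / q) :=
        Real.rpow_le_rpow h0 hle (by positivity)
    _ = M ^ (1 / p) * B ^ (1 / q) := by
        rw [Real.mul_rpow (by positivity) hB0, ← Real.rpow_mul hM.le, hexp]

/-- `L^{p*}` bound for the periodic solution kernel `Ψ`:
`(∫₀ᵀ Ψ(s,t)^{p*} ds)^{1/p*} ≤ C_∞^{1/p} · (C₁ τ)^{1/p*}` where `p* = p/(p−1)`. -/
theorem stmt_4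
    (T τ αlow : ℝ) (hT : 0 < T) (hτ : 0 < τ) (hτ1 : τ ≤ 1) (hαlow : 0 < αlow)
    (α : ℝ → ℝ)
    (hint : IntegrableOn α (Icc 0 T) volume)
    (hαge : ∀ᵐ r ∂(volume.restrict (Icc (0:ℝ) T)), αlow ≤ α r)
    (Φ Ψ : ℝ → ℝ → ℝ)
    (hΦ : ∀ s t : ℝ, Φ s t = Real.exp (-(1/τ) * ∫ r in s..t, α r))
    (hΨ : ∀ s t : ℝ, Ψ s t = Φ s T * Φ 0 t / (1 - Φ 0 T)
      + Set.indicator (Set.Ioc (0:ℝ) t) (fun _ => (1:ℝ)) s * Φ s t)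
    (Cinf C1 : ℝ)
    (hCinf : Cinf = 1 + (1 - Real.exp (-(αlow * T)))⁻¹)
    (hC1 : C1 = Cinf / αlow)
    (p pstar : ℝ) (hp : 1 < p) (hpstar : pstar = p / (p - 1)) :
    ∀ t ∈ Icc (0:ℝ) T,
      (∫ s in (0:ℝ)..T, (Ψ s t) ^ pstar) ^ (1 / pstar)
        ≤ Cinf ^ (1 / p) * (C1 * τ) ^ (1 / pstar) := by
  intro t ht
  have hpq : p.HolderConjugate pstar := (Real.holderConjugate_iff_eq_conjExponent hp).2 hpstar
  set c := αlow / τ with hc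
  have hc0 : 0 < c := by positivity
  have hΦle : ∀ s t, 0 ≤ s → s ≤ t → t ≤ T → Φ s t ≤ Real.exp (-(c * (t - s))) := by
    intro s t hs hst ht
    have h := mul_sub_le_intervalIntegral_of_ae_le hint hαge hs hst ht
    rw [hΦ, Real.exp_le_exp]
    have h' := mul_le_mul_of_nonneg_left h (one_div_pos.2 hτ).le
    have e : 1 / τ * (αlow * (t - s)) = c * (t - s) := by rw [hc]; ring
    linarith
  have hΦ0 : ∀ s t, 0 < Φ s t := fun s t => by rw [hΦ]; positivity
  have hΦ1 : ∀ s t, 0 ≤ s → s ≤ t → t ≤ T → Φ s t ≤ 1 := by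
    intro s t hs hst ht
    refine (hΦle s t hs hst ht).trans (Real.exp_le_one_iff.2 ?_)
    have := mul_nonneg hc0.le (sub_nonneg.2 hst)
    linarith
  set D := 1 - Real.exp (-(αlow * T)) with hD
  have hD0 : 0 < D := by
    have : Real.exp (-(αlow * T)) < 1 := Real.exp_lt_one_iff.2 (neg_neg_of_pos (mul_pos hαlow hT))
    linarith
  have hDle : D ≤ 1 - Φ 0 T := by
    have h1 := hΦle 0 T le_rfl hT.le le_rfl
    have h2 : Real.exp (-(c * (T - 0))) ≤ Real.exp (-(αlow * T)) := by
      rw [Real.exp_le_exp, sub_zero]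
      have : αlow ≤ c := le_div_self hαlow.le hτ hτ1
      nlinarith
    linarith
  have hfirst : ∀ s, Φ s T * Φ 0 t / (1 - Φ 0 T) ≤ D⁻¹ * Φ s T := by
    intro s
    rw [div_eq_inv_mul]
    have := hΦ1 0 t le_rfl ht.1 ht.2
    exact mul_le_mul (inv_anti₀ hD0 hDle)
      (mul_le_of_le_one_right (hΦ0 s T).le this)
      (mul_pos (hΦ0 _ _) (hΦ0 _ _)).le (inv_pos.2 hD0).le
  have hfirst0 : ∀ s, 0 ≤ Φ s T * Φ 0 t / (1 - Φ 0 T) := fun s =>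
    div_nonneg (mul_pos (hΦ0 _ _) (hΦ0 _ _)).le (hD0.le.trans hDle)
  have hDi : 0 < D⁻¹ := inv_pos.2 hD0
  have hi1 : IntegrableOn (fun s => D⁻¹ * Real.exp (-(c * (T - s)))) (Ioc 0 T) volume :=
    (Continuous.integrableOn_Icc (by fun_prop)).mono_set Ioc_subset_Icc_self
  have hi2 : IntegrableOn ((Ioc 0 t).indicator fun s => Real.exp (-(c * (t - s)))) (Ioc 0 T)
      volume :=
    ((Continuous.integrableOn_Icc (by fun_prop)).mono_set Ioc_subset_Icc_self).indicator
      measurableSet_Ioc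
  refine rpow_intervalIntegral_rpow_le hpq hT.le (by rw [hCinf]; positivity)
    (g := fun s => D⁻¹ * Real.exp (-(c * (T - s))) +
      (Ioc 0 t).indicator (fun s => Real.exp (-(c * (t - s)))) s) ?_ ?_ ?_ (hi1.add hi2) ?_
  · intro s _
    rw [hΨ]
    exact add_nonneg (hfirst0 s)
      (mul_nonneg (indicator_nonneg (fun _ _ => zero_le_one) s) (hΦ0 s t).le)
  · intro s hs
    have h1 := (hfirst s).trans
      (mul_le_of_le_one_right hDi.le (hΦ1 s T hs.1.le hs.2 le_rfl))
    rw [hΨ, hCinf]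
    by_cases hst : s ∈ Ioc 0 t
    · have := hΦ1 s t hs.1.le hst.2 ht.2
      rw [indicator_of_mem hst]
      linarith
    · rw [indicator_of_notMem hst]
      linarith
  · intro s hs
    have h1 := (hfirst s).trans
      (mul_le_mul_of_nonneg_left (hΦle s T hs.1.le hs.2 le_rfl) hDi.le)
    rw [hΨ]
    by_cases hst : s ∈ Ioc 0 t
    · have := hΦle s t hs.1.le hst.2 ht.2
      simp only [indicator_of_mem hst]
      linarith
    · simp only [indicator_of_notMem hst]
      linarith
  · rw [integral_add hi1 hi2, integral_const_mul, setIntegral_indicator measurableSet_Ioc,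
      inter_eq_self_of_subset_right (Ioc_subset_Ioc_right ht.2),
      ← intervalIntegral.integral_of_le hT.le, ← intervalIntegral.integral_of_le ht.1]
    have h1 := mul_le_mul_of_nonneg_left (intervalIntegral_exp_neg_mul_sub_le hc0 T) hDi.le
    have h2 := intervalIntegral_exp_neg_mul_sub_le hc0 t
    have e : C1 * τ = D⁻¹ * (1 / c) + 1 / c := by
      rw [hC1, hCinf, hc, one_div_div]
      ring
    linarith
end

section
/- Let T > 0, let 0 < α̲ ≤ ᾱ, and let p ∈ [1,∞). There exists a constant C > 0 depending only on α̲, ᾱ, T and p such that the following holds: for every τ ∈ (0,1], every continuous α : [0,T] → ℝ with α̲ ≤ α(r) ≤ ᾱ for all r, every continuous h : [0,T] → ℝ, and every continuously differentiable y : [0,T] → ℝ satisfying τ y'(t) + α(t) y(t) = h(t) for all t ∈ [0,T] and the time-periodicity condition y(0) = y(T), one has τ · ‖y'‖_{L^p(0,T)} ≤ ‖h‖_{L^p(0,T)} · (1 + C · τ^{−1/p}). -/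
open MeasureTheory Set

/-- If `g` takes the same value at both ends of `[0,T]`, any continuous majorant of its derivative
has nonnegative integral. -/
lemma integral_nonneg_of_deriv_le_of_periodic {T : ℝ} (hT : 0 < T) {g g' G : ℝ → ℝ}
    (hg : ∀ t ∈ Icc (0 : ℝ) T, HasDerivWithinAt g (g' t) (Icc 0 T) t)
    (hG : ContinuousOn G (Icc 0 T)) (hle : ∀ t ∈ Icc (0 : ℝ) T, g' t ≤ G t) (hper : g 0 = g T) :
    0 ≤ ∫ t in (0 : ℝ)..T, G t := by
  have h := intervalIntegral.sub_le_integral_of_hasDeriv_right_of_le hT.le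
    (fun t ht => (hg t ht).continuousWithinAt)
    (fun t ht => ((hg t (Ioo_subset_Icc_self ht)).hasDerivAt
      (Icc_mem_nhds ht.1 ht.2)).hasDerivWithinAt)
    (hG.integrableOn_Icc) (fun t ht => hle t (Ioo_subset_Icc_self ht))
  linarith

/-- Real version of `NNReal.rpow_add_le_mul_rpow_add_rpow`. -/
lemma add_rpow_le_mul_rpow_add_rpow {p u v : ℝ} (hu : 0 ≤ u) (hv : 0 ≤ v) (hp : 1 ≤ p) :
    (u + v) ^ p ≤ 2 ^ (p - 1) * (u ^ p + v ^ p) := by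
  lift u to NNReal using hu
  lift v to NNReal using hv
  exact_mod_cast NNReal.rpow_add_le_mul_rpow_add_rpow u v hp

/-- A Young-type inequality with an absorbing constant. -/
lemma mul_rpow_sub_one_le {a p u v : ℝ} (ha : 0 < a) (hp : 1 ≤ p) (hu : 0 ≤ u) (hv : 0 ≤ v) :
    u * v ^ (p - 1) ≤ a / 2 * v ^ p + (2 / a) ^ (p - 1) * u ^ p := by
  have split : ∀ x : ℝ, 0 ≤ x → x ^ p = x * x ^ (p - 1) := fun x hx => by
    rw [mul_comm, ← Real.rpow_add_one' hx (by linarith), sub_add_cancel]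
  rcases le_total u (a / 2 * v) with h | h
  · have h1 : u * v ^ (p - 1) ≤ a / 2 * v * v ^ (p - 1) := by gcongr
    have h2 : 0 ≤ (2 / a) ^ (p - 1) * u ^ p := by positivity
    rw [split v hv]
    linarith
  · have hvu : v ≤ 2 / a * u := by
      rw [div_mul_eq_mul_div, le_div_iff₀ ha]
      linarith
    have h1 : u * v ^ (p - 1) ≤ u * (2 / a * u) ^ (p - 1) := by
      have := Real.rpow_le_rpow hv hvu (sub_nonneg.2 hp)
      gcongr
    rw [Real.mul_rpow (by positivity) hu] at h1
    have h2 : 0 ≤ a / 2 * v ^ p := by positivity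
    rw [split u hu]
    linarith

/-- `L^1` bound for time-periodic solutions of the relaxation equation. -/
lemma integral_abs_le_of_periodic {T a τ : ℝ} (hT : 0 < T) (ha : 0 < a) (hτ : 0 < τ)
    {α h y y' : ℝ → ℝ} (hα : ∀ t ∈ Icc (0 : ℝ) T, a ≤ α t) (hh : ContinuousOn h (Icc 0 T))
    (hy : ∀ t ∈ Icc (0 : ℝ) T, HasDerivWithinAt y (y' t) (Icc 0 T) t)
    (hode : ∀ t ∈ Icc (0 : ℝ) T, τ * y' t + α t * y t = h t) (hper : y 0 = y T) :
    a * ∫ t in (0 : ℝ)..T, |y t| ≤ ∫ t in (0 : ℝ)..T, |h t| := by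
  have hyc : ContinuousOn y (Icc 0 T) := fun t ht => (hy t ht).continuousWithinAt
  have hyi : IntervalIntegrable (fun t => |y t|) volume 0 T :=
    (hyc.abs).intervalIntegrable_of_Icc hT.le
  have hhi : IntervalIntegrable (fun t => |h t|) volume 0 T :=
    (hh.abs).intervalIntegrable_of_Icc hT.le
  refine le_of_forall_pos_le_add fun δ hδ => ?_
  set ε : ℝ := δ / (a * T)
  have hε : 0 < ε := by positivity
  have hpos : ∀ t, 0 < y t ^ 2 + ε ^ 2 := fun t => by positivity
  have key := integral_nonneg_of_deriv_le_of_periodic hT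
    (g := fun t => τ * √(y t ^ 2 + ε ^ 2))
    (G := fun t => |h t| - a * |y t| + a * ε)
    (fun t ht => ((((hy t ht).pow 2).add_const (ε ^ 2)).sqrt (hpos t).ne').const_mul τ)
    (by fun_prop) (fun t ht => ?_) (by simp only [hper])
  · rw [intervalIntegral.integral_add (hhi.sub (hyi.const_mul a)) (by simp),
      intervalIntegral.integral_sub hhi (hyi.const_mul a),
      intervalIntegral.integral_const_mul, intervalIntegral.integral_const] at key
    have : (T - 0) • (a * ε) = δ := by
      simp only [ε, smul_eq_mul]
      field_simp
      ring
    linarith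
  · have hτy : τ * y' t = h t - α t * y t := by linarith [hode t ht]
    set s := √(y t ^ 2 + ε ^ 2)
    have hs : 0 < s := Real.sqrt_pos.2 (hpos t)
    have hs2 : s ^ 2 = y t ^ 2 + ε ^ 2 := Real.sq_sqrt (hpos t).le
    have hys : |y t| ≤ s := Real.abs_le_sqrt (by nlinarith)
    have hεs : ε ≤ s := Real.le_sqrt_of_sq_le (by nlinarith [sq_nonneg (y t)])
    have e : τ * ((2 : ℕ) * y t ^ (2 - 1) * y' t / (2 * s)) = (h t - α t * y t) * y t / s := by
      rw [← hτy]
      push_cast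
      field_simp
    refine e.trans_le ?_
    rw [div_le_iff₀ hs]
    have h1 : h t * y t ≤ |h t| * s :=
      (le_abs_self _).trans (by rw [abs_mul]; gcongr)
    have h2 : a * y t ^ 2 ≤ α t * y t ^ 2 := by gcongr; exact hα t ht
    have h3 : a * (|y t| * s - ε * s) ≤ a * y t ^ 2 := by
      have : |y t| * s - ε * s ≤ y t ^ 2 := by nlinarith
      gcongr
    nlinarith

/-- `L^p` bound for time-periodic solutions of the relaxation equation, uniform in `τ`. -/
lemma integral_abs_rpow_le_of_periodic {T a τ p : ℝ} (hT : 0 < T) (ha : 0 < a) (hτ : 0 < τ)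
    (hp : 1 ≤ p)
    {α h y y' : ℝ → ℝ} (hα : ∀ t ∈ Icc (0 : ℝ) T, a ≤ α t) (hh : ContinuousOn h (Icc 0 T))
    (hy : ∀ t ∈ Icc (0 : ℝ) T, HasDerivWithinAt y (y' t) (Icc 0 T) t)
    (hode : ∀ t ∈ Icc (0 : ℝ) T, τ * y' t + α t * y t = h t) (hper : y 0 = y T) :
    ∫ t in (0 : ℝ)..T, |y t| ^ p ≤ (2 / a) ^ p * ∫ t in (0 : ℝ)..T, |h t| ^ p := by
  have hyc : ContinuousOn y (Icc 0 T) := fun t ht => (hy t ht).continuousWithinAt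
  have hyp : ContinuousOn (fun t => |y t| ^ p) (Icc 0 T) :=
    hyc.abs.rpow_const fun _ _ => Or.inr (by linarith)
  have hhp : ContinuousOn (fun t => |h t| ^ p) (Icc 0 T) :=
    hh.abs.rpow_const fun _ _ => Or.inr (by linarith)
  have hyi := hyp.intervalIntegrable_of_Icc (μ := volume) hT.le
  have hhi := hhp.intervalIntegrable_of_Icc (μ := volume) hT.le
  rcases hp.eq_or_lt with rfl | hp1
  · simp only [Real.rpow_one]
    have h1 := integral_abs_le_of_periodic hT ha hτ hα hh hy hode hper
    have h0 : 0 ≤ ∫ t in (0 : ℝ)..T, |h t| :=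
      intervalIntegral.integral_nonneg hT.le fun _ _ => abs_nonneg _
    rw [div_mul_eq_mul_div, le_div_iff₀ ha]
    linarith
  set K := (2 / a) ^ (p - 1) with hK
  have key := integral_nonneg_of_deriv_le_of_periodic hT
    (g := fun t => τ / p * |y t| ^ p)
    (G := fun t => K * |h t| ^ p - a / 2 * |y t| ^ p)
    (fun t ht => (((hasDerivAt_abs_rpow (y t) hp1).comp_hasDerivWithinAt t (hy t ht)).const_mul
      (τ / p)))
    (by fun_prop) (fun t ht => ?_) (by simp only [hper])
  · rw [intervalIntegral.integral_sub (hhi.const_mul K) (hyi.const_mul _),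
      intervalIntegral.integral_const_mul, intervalIntegral.integral_const_mul] at key
    have e : (2 / a) ^ p = 2 / a * K := by
      rw [hK, mul_comm, ← Real.rpow_add_one' (by positivity) (by linarith), sub_add_cancel]
    rw [e, mul_assoc, div_mul_eq_mul_div, le_div_iff₀ ha]
    linarith
  · have hτy : τ * y' t = h t - α t * y t := by linarith [hode t ht]
    have e : τ / p * (p * |y t| ^ (p - 2) * y t * y' t)
        = |y t| ^ (p - 2) * y t * (h t - α t * y t) := by
      rw [← hτy]
      field_simp
    rw [e]
    have y1 : |y t| ^ (p - 2) * |y t| = |y t| ^ (p - 1) := by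
      rw [← Real.rpow_add_one' (abs_nonneg _) (by linarith)]
      ring_nf
    have y2 : |y t| ^ (p - 2) * y t * y t = |y t| ^ p := by
      rw [mul_assoc, ← abs_mul_abs_self (y t), ← mul_assoc, y1,
        ← Real.rpow_add_one' (abs_nonneg _) (by linarith), sub_add_cancel]
    have h1 : |y t| ^ (p - 2) * y t * h t ≤ |h t| * |y t| ^ (p - 1) := by
      rw [← y1]
      have : y t * h t ≤ |y t| * |h t| := (le_abs_self _).trans_eq (abs_mul _ _)
      have h0 : 0 ≤ |y t| ^ (p - 2) := by positivity
      nlinarith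
    have h2 : a * |y t| ^ p ≤ α t * |y t| ^ p := by gcongr; exact hα t ht
    have h3 := mul_rpow_sub_one_le ha hp (abs_nonneg (h t)) (abs_nonneg (y t))
    have h4 : |y t| ^ (p - 2) * y t * (h t - α t * y t)
        = |y t| ^ (p - 2) * y t * h t - α t * |y t| ^ p := by
      rw [← y2]
      ring
    linarith

/-- uniform-in-`τ` `L^p` estimate for the time derivative of
time-periodic solutions of `τ y' + α y = h`:
`τ ‖y'‖_{L^p(0,T)} ≤ ‖h‖_{L^p(0,T)} (1 + C τ^{−1/p})`. -/
theorem stmt_6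
    (T αlow αhigh p : ℝ) (hT : 0 < T) (hαlow : 0 < αlow) (hαh : αlow ≤ αhigh)
    (hp : 1 ≤ p) :
    ∃ C > (0:ℝ), ∀ τ ∈ Ioc (0:ℝ) 1, ∀ α h y y' : ℝ → ℝ,
      ContinuousOn α (Icc 0 T) →
      (∀ r ∈ Icc (0:ℝ) T, αlow ≤ α r ∧ α r ≤ αhigh) →
      ContinuousOn h (Icc 0 T) →
      ContinuousOn y' (Icc 0 T) →
      (∀ t ∈ Icc (0:ℝ) T, HasDerivWithinAt y (y' t) (Icc 0 T) t) →
      (∀ t ∈ Icc (0:ℝ) T, τ * y' t + α t * y t = h t) →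
      y 0 = y T →
      τ * (∫ t in (0:ℝ)..T, |y' t| ^ p) ^ (1 / p)
        ≤ (∫ t in (0:ℝ)..T, |h t| ^ p) ^ (1 / p) * (1 + C * τ ^ (-(1 / p))) := by
  have hhigh : 0 < αhigh := hαlow.trans_le hαh
  have hp0 : 0 < p := by linarith
  set M : ℝ := 2 ^ (p - 1) * (1 + αhigh ^ p * (2 / αlow) ^ p) with hM
  have hM0 : 0 < M := by positivity
  refine ⟨M ^ (1 / p), by positivity, ?_⟩
  rintro τ ⟨hτ, hτ1⟩ α h y y' - hα hh hy' hy hode hper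
  have hyc : ContinuousOn y (Icc 0 T) := fun t ht => (hy t ht).continuousWithinAt
  have hyi : IntervalIntegrable (fun t => |y t| ^ p) volume 0 T :=
    (hyc.abs.rpow_const fun _ _ => Or.inr hp0.le).intervalIntegrable_of_Icc hT.le
  have hhi : IntervalIntegrable (fun t => |h t| ^ p) volume 0 T :=
    (hh.abs.rpow_const fun _ _ => Or.inr hp0.le).intervalIntegrable_of_Icc hT.le
  have hyi' : IntervalIntegrable (fun t => |y' t| ^ p) volume 0 T :=
    (hy'.abs.rpow_const fun _ _ => Or.inr hp0.le).intervalIntegrable_of_Icc hT.le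
  have hy'0 : 0 ≤ ∫ t in (0:ℝ)..T, |y' t| ^ p :=
    intervalIntegral.integral_nonneg hT.le fun _ _ => by positivity
  have hh0 : 0 ≤ ∫ t in (0:ℝ)..T, |h t| ^ p :=
    intervalIntegral.integral_nonneg hT.le fun _ _ => by positivity
  have bound := integral_abs_rpow_le_of_periodic hT hαlow hτ hp (fun t ht => (hα t ht).1)
    hh hy hode hper
  have ptwise : ∀ t ∈ Icc (0:ℝ) T,
      τ ^ p * |y' t| ^ p ≤ 2 ^ (p - 1) * (|h t| ^ p + αhigh ^ p * |y t| ^ p) := by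
    intro t ht
    have hα0 : 0 ≤ α t := hαlow.le.trans (hα t ht).1
    have e : τ * y' t = h t - α t * y t := by linarith [hode t ht]
    have h1 : τ * |y' t| ≤ |h t| + αhigh * |y t| := by
      calc τ * |y' t| = |h t - α t * y t| := by rw [← e, abs_mul, abs_of_pos hτ]
        _ ≤ |h t| + |α t * y t| := abs_sub _ _
        _ = |h t| + α t * |y t| := by rw [abs_mul, abs_of_nonneg hα0]
        _ ≤ |h t| + αhigh * |y t| := by gcongr; exact (hα t ht).2
    rw [← Real.mul_rpow hτ.le (abs_nonneg _), ← Real.mul_rpow hhigh.le (abs_nonneg _)]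
    exact (Real.rpow_le_rpow (by positivity) h1 hp0.le).trans
      (add_rpow_le_mul_rpow_add_rpow (by positivity) (by positivity) hp)
  have int_le : τ ^ p * ∫ t in (0:ℝ)..T, |y' t| ^ p ≤ M * ∫ t in (0:ℝ)..T, |h t| ^ p := by
    have h1 := intervalIntegral.integral_mono_on hT.le (hyi'.const_mul (τ ^ p))
      ((hhi.add (hyi.const_mul (αhigh ^ p))).const_mul (2 ^ (p - 1))) ptwise
    rw [intervalIntegral.integral_const_mul, intervalIntegral.integral_const_mul,
      intervalIntegral.integral_add hhi (hyi.const_mul (αhigh ^ p)),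
      intervalIntegral.integral_const_mul] at h1
    refine h1.trans ?_
    rw [hM, mul_assoc, add_mul, one_mul, mul_assoc (αhigh ^ p)]
    gcongr
  have norm_le := Real.rpow_le_rpow (by positivity) int_le (one_div_nonneg.2 hp0.le)
  rw [Real.mul_rpow (by positivity) hy'0, Real.mul_rpow hM0.le hh0, ← Real.rpow_mul hτ.le,
    mul_one_div_cancel hp0.ne', Real.rpow_one] at norm_le
  refine norm_le.trans ?_
  rw [mul_comm]
  have hτp : 1 ≤ τ ^ (-(1 / p)) :=
    Real.one_le_rpow_of_pos_of_le_one_of_nonpos hτ hτ1 (by simpa using hp0.le)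
  have hMp : 0 ≤ M ^ (1 / p) := by positivity
  gcongr
  nlinarith
end
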